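/- Let G be a finite group acting transitively and faithfully on a finite set Ω and let α ∈ Ω. If |Ω|/2 < |Ω_{α,1}| + |Ω_{α,2}| < |Ω|, then for every β ∈ Ω_{α,4} and every ω ∈ Ω_{α,2} ∩ Ω_{β,2}, one has G_ω = (G_α ∩ G_ω)(G_β ∩ G_ω), i.e., every element of G_ω is a product of an element of G_α ∩ G_ω and an element of G_β ∩ G_ω. -/

import Mathlib

open MulAction Pointwise

theorem Subgroup.card_inf_mul_relIndex {G : Type*} [Group G] (H K : Subgroup G) :
    Nat.card (H ⊓ K : Subgroup G) * H.relIndex K = Nat.card K := by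
  rw [← Subgroup.relIndex_bot_left, ← Subgroup.relIndex_bot_left, ← Subgroup.inf_relIndex_right H K]
  exact Subgroup.relIndex_mul_relIndex _ _ _ bot_le inf_le_right

theorem MulAction.card_orbit_stabilizer {G Ω : Type*} [Group G] [MulAction G Ω] (α δ : Ω) :
    Nat.card (orbit (stabilizer G α) δ) = (stabilizer G δ).relIndex (stabilizer G α) := by
  rw [Nat.card_coe_set_eq, ← index_stabilizer]
  rfl

theorem MulAction.card_stabilizer_eq {G Ω : Type*} [Group G] [MulAction G Ω]
    [IsPretransitive G Ω] (α β : Ω) :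
    Nat.card (stabilizer G α) = Nat.card (stabilizer G β) :=
  Nat.card_congr (stabilizerEquivStabilizerOfOrbitRel (exists_smul_eq G β α)).toEquiv

theorem MulAction.relIndex_stabilizer_comm {G Ω : Type*} [Group G] [Finite G] [MulAction G Ω]
    [IsPretransitive G Ω] (α β : Ω) :
    (stabilizer G α).relIndex (stabilizer G β) = (stabilizer G β).relIndex (stabilizer G α) := by
  have h := Subgroup.card_inf_mul_relIndex (stabilizer G α) (stabilizer G β)
  rw [card_stabilizer_eq β α, inf_comm,
    ← Subgroup.card_inf_mul_relIndex (stabilizer G β) (stabilizer G α)] at h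
  exact Nat.eq_of_mul_eq_mul_left Nat.card_pos h

theorem Subgroup.coe_eq_mul_of_relIndex_eq_two {G : Type*} [Group G] {A B S : Subgroup G}
    (hA : A.relIndex S = 2) (hB : ¬ B ⊓ S ≤ A) :
    (S : Set G) = ((A ⊓ S : Subgroup G) : Set G) * ((B ⊓ S : Subgroup G) : Set G) := by
  obtain ⟨b, hb, hbA⟩ := SetLike.not_le_iff_exists.mp hB
  refine Set.Subset.antisymm (fun g hg => ?_) ?_
  · by_cases hgA : g ∈ A
    · exact ⟨g, ⟨hgA, hg⟩, 1, one_mem _, mul_one g⟩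
    · have hmul := Subgroup.mul_mem_iff_of_index_two hA (a := ⟨g, hg⟩) (b := ⟨b, hb.2⟩⁻¹)
      refine ⟨g * b⁻¹, ⟨hmul.mpr ?_, S.mul_mem hg (S.inv_mem hb.2)⟩, b, hb, by simp⟩
      simp [Subgroup.mem_subgroupOf, hgA, hbA]
  · rintro _ ⟨a, ha, c, hc, rfl⟩
    exact S.mul_mem ha.2 hc.2

theorem stmt_7 {G Ω : Type*} [Group G] [Finite G] [Finite Ω] [MulAction G Ω]
    [IsPretransitive G Ω] [FaithfulSMul G Ω] (α : Ω)
    (h1 : (Nat.card Ω : ℚ) / 2 <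
      ({δ : Ω | Nat.card (orbit (stabilizer G α) δ) = 1}.ncard : ℚ)
      + ({δ : Ω | Nat.card (orbit (stabilizer G α) δ) = 2}.ncard : ℚ))
    (h2 : ({δ : Ω | Nat.card (orbit (stabilizer G α) δ) = 1}.ncard : ℚ)
      + ({δ : Ω | Nat.card (orbit (stabilizer G α) δ) = 2}.ncard : ℚ)
      < (Nat.card Ω : ℚ)) :
    ∀ β ∈ {δ : Ω | Nat.card (orbit (stabilizer G α) δ) = 4},
      ∀ ω ∈ {δ : Ω | Nat.card (orbit (stabilizer G α) δ) = 2} ∩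
        {δ : Ω | Nat.card (orbit (stabilizer G β) δ) = 2},
        ((stabilizer G ω : Set G)) =
          ((stabilizer G α ⊓ stabilizer G ω : Subgroup G) : Set G) *
          ((stabilizer G β ⊓ stabilizer G ω : Subgroup G) : Set G) := by
  rintro β (hβ : _ = 4) ω ⟨hα : _ = 2, hβω : _ = 2⟩
  rw [card_orbit_stabilizer] at hβ hα hβω
  rw [relIndex_stabilizer_comm] at hα
  exact Subgroup.coe_eq_mul_of_relIndex_eq_two hα fun hle => by
    have hcard := Subgroup.card_inf_mul_relIndex (stabilizer G ω) (stabilizer G β)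
    have hcard' := Subgroup.card_inf_mul_relIndex (stabilizer G β) (stabilizer G α)
    rw [hβω] at hcard
    rw [hβ, card_stabilizer_eq α β] at hcard'
    have hinf_le := Subgroup.card_le_of_le (le_inf inf_le_left hle :
      stabilizer G β ⊓ stabilizer G ω ≤ stabilizer G β ⊓ stabilizer G α)
    rw [inf_comm (stabilizer G β) (stabilizer G ω)] at hinf_le
    have hpos : 0 < Nat.card (stabilizer G β) := Nat.card_pos
    omega
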